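/- If a transitive topological dynamical system (X,T) is disjoint from every minimal topological dynamical system, then (X,T) is weakly mixing and its set of minimal points is dense in X (i.e., (X,T) is a weakly mixing M-system). -/

import Mathlib

open Set Function Filter Topology

structure TDS where
  carrier : Type
  [ms : MetricSpace carrier]
  [cs : CompactSpace carrier]
  map : carrier → carrier
  cont : Continuous map
  surj : Function.Surjective map

attribute [instance] TDS.ms TDS.cs

def orbit {X : Type*} (T : X → X) (x : X) : Set X :=
  Set.range fun n : ℕ => T^[n] x

def IsMinimalSys {Y : Type*} [TopologicalSpace Y] (S : Y → Y) : Prop :=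
  ∀ y : Y, Dense (orbit S y)

def IsTransitiveSys {X : Type*} [TopologicalSpace X] (T : X → X) : Prop :=
  ∀ U V : Set X, IsOpen U → IsOpen V → U.Nonempty → V.Nonempty →
    {n : ℕ | (U ∩ T^[n] ⁻¹' V).Nonempty}.Infinite

def IsWeaklyMixingSys {X : Type*} [TopologicalSpace X] (T : X → X) : Prop :=
  IsTransitiveSys fun p : X × X => (T p.1, T p.2)

def IsJoining {X Y : Type*} [TopologicalSpace X] [TopologicalSpace Y]
    (T : X → X) (S : Y → Y) (J : Set (X × Y)) : Prop :=
  J.Nonempty ∧ IsClosed J ∧ (∀ p ∈ J, (T p.1, S p.2) ∈ J) ∧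
    Prod.fst '' J = Set.univ ∧ Prod.snd '' J = Set.univ

def DisjointSys {X Y : Type*} [TopologicalSpace X] [TopologicalSpace Y]
    (T : X → X) (S : Y → Y) : Prop :=
  ∀ J : Set (X × Y), IsJoining T S J → J = Set.univ

def Syndetic (A : Set ℕ) : Prop :=
  ∃ N : ℕ, ∀ i : ℕ, ∃ j ≤ N, i + j ∈ A

def Thick (A : Set ℕ) : Prop :=
  ∀ L : ℕ, ∃ n : ℕ, ∀ j ≤ L, n + j ∈ A

def IsMinimalPoint {X : Type*} [TopologicalSpace X] (T : X → X) (x : X) : Prop :=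
  ∀ y ∈ closure (orbit T x), closure (orbit T x) ⊆ closure (orbit T y)

def Proximal {X : Type*} [MetricSpace X] (T : X → X) (x y : X) : Prop :=
  ∃ u : ℕ → ℕ, Filter.Tendsto (fun i => dist (T^[u i] x) (T^[u i] y)) Filter.atTop (nhds 0)

def IsDistalPoint {X : Type*} [MetricSpace X] (T : X → X) (x : X) : Prop :=
  ∀ y ∈ closure (orbit T x), Proximal T x y → y = x

def DynSyndetic (B : Set ℕ) : Prop :=
  ∃ 𝒴 : TDS, IsMinimalSys 𝒴.map ∧
    ∃ (y : 𝒴.carrier) (V : Set 𝒴.carrier),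
      IsOpen V ∧ y ∈ V ∧ {n : ℕ | 𝒴.map^[n] y ∈ V} ⊆ B

def CentralSet (S : Set ℕ) : Prop :=
  ∃ 𝒵 : TDS, ∃ (z w : 𝒵.carrier) (W : Set 𝒵.carrier),
    IsMinimalPoint 𝒵.map w ∧ Proximal 𝒵.map z w ∧ IsOpen W ∧ w ∈ W ∧
    {n : ℕ | 𝒵.map^[n] z ∈ W} ⊆ S

def CStarSet (A : Set ℕ) : Prop :=
  ∀ S : Set ℕ, CentralSet S → (A ∩ S).Nonempty

lemma self_mem_orbit {X : Type*} (T : X → X) (x : X) : x ∈ orbit T x := ⟨0, rfl⟩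

section Topological

variable {X : Type*} [TopologicalSpace X]

lemma closure_orbit_subset {T : X → X} {C : Set X} (hC : IsClosed C) (hinv : ∀ y ∈ C, T y ∈ C)
    {x : X} (hx : x ∈ C) : closure (orbit T x) ⊆ C := by
  refine closure_minimal ?_ hC
  rintro _ ⟨n, rfl⟩
  have hT : MapsTo T C C := hinv
  exact hT.iterate n hx

lemma map_mem_closure_orbit {T : X → X} (hT : Continuous T) {x y : X}
    (hy : y ∈ closure (orbit T x)) : T y ∈ closure (orbit T x) := by
  refine map_mem_closure hT hy ?_
  rintro _ ⟨n, rfl⟩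
  exact ⟨n + 1, iterate_succ_apply' T n x⟩

lemma Dense.orbit_iterate {T : X → X} (hT : Continuous T) (hTs : Function.Surjective T) {x : X}
    (hx : Dense (orbit T x)) (n : ℕ) : Dense (orbit T (T^[n] x)) := by
  have h := (hTs.iterate n).denseRange.dense_image (hT.iterate n) hx
  refine h.mono ?_
  rintro _ ⟨_, ⟨k, rfl⟩, rfl⟩
  refine ⟨k, ?_⟩
  simp only [← iterate_add_apply, Nat.add_comm]

/-- Every orbit closure of a compact system contains a minimal point. -/
lemma exists_isMinimalPoint_mem_closure_orbit [CompactSpace X] {T : X → X} (hT : Continuous T)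
    (x : X) : ∃ w ∈ closure (orbit T x), IsMinimalPoint T w := by
  let 𝒞 : Set (Set X) := {C | IsClosed C ∧ C.Nonempty ∧ ∀ y ∈ C, T y ∈ C}
  have hx : closure (orbit T x) ∈ 𝒞 :=
    ⟨isClosed_closure, ⟨x, subset_closure (self_mem_orbit T x)⟩, fun _ => map_mem_closure_orbit hT⟩
  obtain ⟨M, hMx, hM⟩ := zorn_superset_nonempty 𝒞 (by
    intro c hc hchain hne
    refine ⟨⋂₀ c, ⟨isClosed_sInter fun s hs => (hc hs).1, ?_, ?_⟩,
      fun s hs => sInter_subset_of_mem hs⟩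
    · have := hne.to_subtype
      rw [sInter_eq_iInter]
      refine IsCompact.nonempty_iInter_of_directed_nonempty_isCompact_isClosed _ ?_
        (fun s => (hc s.2).2.1) (fun s => (hc s.2).1.isCompact) (fun s => (hc s.2).1)
      have hdir : DirectedOn (· ⊇ ·) c := fun s hs t ht => by
        rcases hchain.total hs ht with h | h
        · exact ⟨s, hs, Subset.rfl, h⟩
        · exact ⟨t, ht, h, Subset.rfl⟩
      exact directedOn_iff_directed.1 hdir
    · intro y hy s hs
      exact (hc hs).2.2 y (hy s hs)) _ hx
  obtain ⟨hMc, ⟨w, hw⟩, hMi⟩ := hM.prop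
  have key : ∀ y ∈ M, M ⊆ closure (orbit T y) := fun y hy =>
    hM.le_of_le ⟨isClosed_closure, ⟨y, subset_closure (self_mem_orbit T y)⟩,
      fun _ => map_mem_closure_orbit hT⟩ (closure_orbit_subset hMc hMi hy)
  refine ⟨w, hMx hw, fun y hy => ?_⟩
  have hwM := closure_orbit_subset hMc hMi hw
  exact hwM.trans (key y (hwM hy))

/-- A uniformly recurrent point of a regular system is a minimal point. -/
lemma isMinimalPoint_of_syndetic [RegularSpace X] {T : X → X} (hT : Continuous T) {x : X}
    (h : ∀ W ∈ 𝓝 x, Syndetic {n | T^[n] x ∈ W}) : IsMinimalPoint T x := by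
  intro y hy
  refine closure_orbit_subset isClosed_closure (fun _ => map_mem_closure_orbit hT) ?_
  rw [mem_closure_iff_nhds]
  intro W hW
  obtain ⟨K, hK, hKc, hKW⟩ := exists_mem_nhds_isClosed_subset hW
  obtain ⟨N, hN⟩ := h K hK
  have hcl : IsClosed (⋃ j ∈ Iic N, T^[j] ⁻¹' K) :=
    (finite_Iic N).isClosed_biUnion fun j _ => hKc.preimage (hT.iterate j)
  have hsub : closure (orbit T x) ⊆ ⋃ j ∈ Iic N, T^[j] ⁻¹' K := by
    refine closure_minimal ?_ hcl
    rintro _ ⟨i, rfl⟩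
    obtain ⟨j, hj, hij⟩ := hN i
    refine mem_biUnion (mem_Iic.2 hj) ?_
    rwa [mem_ofPred_eq, Nat.add_comm, iterate_add_apply] at hij
  obtain ⟨j, -, hj⟩ := mem_iUnion₂.1 (hsub hy)
  exact ⟨T^[j] y, hKW hj, j, rfl⟩

lemma IsTransitiveSys.exists_dense_orbit [CompactSpace X] [T2Space X] [SecondCountableTopology X]
    [Nonempty X] {T : X → X} (hT : Continuous T) (htr : IsTransitiveSys T) :
    ∃ x, Dense (orbit T x) := by
  have hd : Dense (⋂ B ∈ TopologicalSpace.countableBasis X, ⋃ n : ℕ, T^[n] ⁻¹' B) := by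
    refine dense_biInter_of_isOpen (fun B hB => isOpen_iUnion fun n =>
      (TopologicalSpace.isOpen_of_mem_countableBasis hB).preimage (hT.iterate n))
      (TopologicalSpace.countable_countableBasis X) fun B hB => ?_
    rw [dense_iff_inter_open]
    intro U hU hne
    obtain ⟨n, z, hzU, hzB⟩ := (htr U B hU (TopologicalSpace.isOpen_of_mem_countableBasis hB) hne
      (TopologicalSpace.nonempty_of_mem_countableBasis hB)).nonempty
    exact ⟨z, hzU, mem_iUnion.2 ⟨n, hzB⟩⟩
  obtain ⟨x, hx⟩ := hd.nonempty
  refine ⟨x, (TopologicalSpace.isBasis_countableBasis X).dense_iff.2 fun B hB _ => ?_⟩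
  obtain ⟨n, hn⟩ := mem_iUnion.1 (mem_iInter₂.1 hx B hB)
  exact ⟨T^[n] x, hn, n, rfl⟩

/-- Petersen's criterion for weak mixing. -/
lemma isWeaklyMixingSys_of_inter {T : X → X} (hT : Continuous T) (hTs : Function.Surjective T)
    (htr : IsTransitiveSys T)
    (h : ∀ U V : Set X, IsOpen U → IsOpen V → U.Nonempty → V.Nonempty →
      ∃ n, (U ∩ T^[n] ⁻¹' U).Nonempty ∧ (U ∩ T^[n] ⁻¹' V).Nonempty) :
    IsWeaklyMixingSys T := by
  have hit : ∀ (n : ℕ) (p : X × X),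
      (fun p : X × X => (T p.1, T p.2))^[n] p = (T^[n] p.1, T^[n] p.2) := fun n p =>
    congrFun (Prod.map_iterate T T n) p
  rintro P Q hP hQ ⟨⟨u₁, u₂⟩, hu⟩ ⟨⟨v₁, v₂⟩, hv⟩
  obtain ⟨U₁, U₂, hU₁, hU₂, hu₁, hu₂, hUP⟩ := isOpen_prod_iff.1 hP u₁ u₂ hu
  obtain ⟨V₁, V₂, hV₁, hV₂, hv₁, hv₂, hVQ⟩ := isOpen_prod_iff.1 hQ v₁ v₂ hv
  obtain ⟨a, hA⟩ := (htr U₁ U₂ hU₁ hU₂ ⟨u₁, hu₁⟩ ⟨u₂, hu₂⟩).nonempty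
  have hAo : IsOpen (U₁ ∩ T^[a] ⁻¹' U₂) := hU₁.inter (hU₂.preimage (hT.iterate a))
  refine infinite_of_not_bddAbove fun ⟨N, hN⟩ => ?_
  obtain ⟨b, hB, hbN⟩ := (htr _ V₁ hAo hV₁ hA ⟨v₁, hv₁⟩).exists_gt N
  obtain ⟨m, ⟨z, hz, hz'⟩, ⟨w, hw, hw'⟩⟩ := h ((U₁ ∩ T^[a] ⁻¹' U₂) ∩ T^[b] ⁻¹' V₁)
    (T^[b] ⁻¹' (T^[a] ⁻¹' V₂)) (hAo.inter (hV₁.preimage (hT.iterate b)))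
    ((hV₂.preimage (hT.iterate a)).preimage (hT.iterate b)) hB
    ((Set.Nonempty.preimage ⟨v₂, hv₂⟩ (hTs.iterate a)).preimage (hTs.iterate b))
  have hmem : b + m ∈ {n : ℕ | (P ∩ (fun p : X × X => (T p.1, T p.2))^[n] ⁻¹' Q).Nonempty} := by
    refine ⟨(z, T^[a] w), hUP ⟨hz.1.1, hw.1.2⟩, ?_⟩
    rw [mem_preimage, hit]
    refine hVQ ⟨?_, ?_⟩
    · have := hz'.2
      rwa [mem_preimage, ← iterate_add_apply] at this
    · have : T^[a] (T^[b] (T^[m] w)) ∈ V₂ := hw'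
      rw [← iterate_add_apply, ← iterate_add_apply] at this
      change T^[b + m] (T^[a] w) ∈ V₂
      rw [← iterate_add_apply]
      convert this using 2
      omega
  have := hN hmem
  omega

end Topological

/-- A minimal point, seen inside its orbit closure, generates a minimal system; so disjointness
makes a transitive point hit open sets simultaneously with it. -/
lemma exists_common_hit {X Z : Type} [TopologicalSpace X] [CompactSpace X] [T2Space X]
    [TopologicalSpace Z] [CompactSpace Z] [TopologicalSpace.MetrizableSpace Z]
    {T : X → X} (hT : Continuous T)
    (hdisj : ∀ 𝒴 : TDS, IsMinimalSys 𝒴.map → DisjointSys T 𝒴.map)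
    {S : Z → Z} (hS : Continuous S) {x : X} (hx : Dense (orbit T x)) {z : Z}
    (hz : IsMinimalPoint S z) {U : Set X} (hU : IsOpen U) (hUne : U.Nonempty) {O : Set Z}
    (hO : IsOpen O) {k : ℕ} (hk : S^[k] z ∈ O) : ∃ n, T^[n] x ∈ U ∧ S^[n] z ∈ O := by
  let C := closure (orbit S z)
  have hCc : IsClosed C := isClosed_closure
  have hmaps : MapsTo S C C := fun _ => map_mem_closure_orbit hS
  let R : C → C := hmaps.restrict S C C
  have hR : Continuous R := hS.restrict hmaps
  have hRit : ∀ n (c : C), ((R^[n] c : C) : Z) = S^[n] c := fun n c => by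
    rw [hmaps.iterate_restrict]; rfl
  have hmin : IsMinimalSys R := by
    intro y
    rw [Subtype.dense_iff]
    intro c hc
    have : Subtype.val '' orbit R y = orbit S (y : Z) := by
      rw [orbit, orbit, ← range_comp]
      exact congrArg range (funext fun n => hRit n y)
    rw [this]
    exact hz y y.2 hc
  have : CompactSpace C := isCompact_iff_compactSpace.1 hCc.isCompact
  have hsurj : Function.Surjective R := by
    intro c
    have hcl : IsClosed (range R) := (isCompact_range hR).isClosed
    have hd : Dense (range R) := by
      refine (hmin (R c)).mono ?_
      rintro _ ⟨n, rfl⟩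
      exact ⟨R^[n] c, by rw [← iterate_succ_apply' R n c, iterate_succ_apply]⟩
    have := hd.closure_eq
    rw [hcl.closure_eq] at this
    exact (this ▸ mem_univ c : c ∈ range R)
  let _ : MetricSpace C := TopologicalSpace.metrizableSpaceMetric C
  let 𝒴 : TDS := { carrier := C, map := R, cont := hR, surj := hsurj }
  let z' : C := ⟨z, subset_closure (self_mem_orbit S z)⟩
  let F : X × C → X × C := fun p => (T p.1, R p.2)
  have hF : Continuous F := (hT.comp continuous_fst).prodMk (hR.comp continuous_snd)
  have hFit : ∀ n (p : X × C), F^[n] p = (T^[n] p.1, R^[n] p.2) := fun n p =>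
    congrFun (Prod.map_iterate T R n) p
  let J : Set (X × C) := closure (orbit F (x, z'))
  have hJ : IsJoining T R J := by
    have hJc : IsCompact J := isClosed_closure.isCompact
    refine ⟨⟨(x, z'), subset_closure (self_mem_orbit _ _)⟩, isClosed_closure,
      fun p hp => map_mem_closure_orbit hF hp, ?_, ?_⟩
    · have hc : IsClosed (Prod.fst '' J) := (hJc.image continuous_fst).isClosed
      rw [← hc.closure_eq]
      refine (hx.mono ?_).closure_eq
      rintro _ ⟨n, rfl⟩
      exact ⟨F^[n] (x, z'), subset_closure ⟨n, rfl⟩, by rw [hFit]⟩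
    · have hc : IsClosed (Prod.snd '' J) := (hJc.image continuous_snd).isClosed
      rw [← hc.closure_eq]
      refine ((hmin z').mono ?_).closure_eq
      rintro _ ⟨n, rfl⟩
      exact ⟨F^[n] (x, z'), subset_closure ⟨n, rfl⟩, by rw [hFit]⟩
  have hJu : J = univ := hdisj 𝒴 hmin J hJ
  obtain ⟨u, hu⟩ := hUne
  have hmem : (u, R^[k] z') ∈ closure (orbit F (x, z')) := by
    change _ ∈ J
    rw [hJu]; trivial
  obtain ⟨_, hp, n, rfl⟩ := mem_closure_iff.1 hmem (U ×ˢ (Subtype.val ⁻¹' O))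
    (hU.prod (hO.preimage continuous_subtype_val)) ⟨hu, by rw [mem_preimage, hRit]; exact hk⟩
  simp only [hFit] at hp
  exact ⟨n, hp.1, by have := hp.2; rwa [mem_preimage, hRit] at this⟩


/-- Words that are concatenations `z₀ w z₁ w ⋯ w zₘ` whose gaps `zᵢ` have length at most `D`. -/
inductive Spaced {α : Type*} (w : List α) (D : ℕ) : List α → Prop
  | short {z : List α} : z.length ≤ D → Spaced w D z
  | step {z u : List α} : z.length ≤ D → Spaced w D u → Spaced w D (z ++ (w ++ u))

lemma Spaced.append {α : Type*} {w : List α} {D : ℕ} {u v : List α} (hu : Spaced w D u)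
    (hv : Spaced w D v) : Spaced w D (u ++ (w ++ v)) := by
  induction hu with
  | short hz => exact .step hz hv
  | step hz _ ih => simpa using Spaced.step hz ih

/-- In a spaced word, `w` begins within distance `D` of the start, and within distance
`|w| + D` of any position. -/
lemma Spaced.exists_prefix_drop {α : Type*} {w : List α} {D : ℕ} {u : List α} (hu : Spaced w D u) :
    (D + w.length < u.length → ∃ p ≤ D, w <+: u.drop p) ∧
    ∀ n, n + 2 * (D + w.length) < u.length → ∃ j ≤ w.length + D, w <+: u.drop (n + j) := by
  induction hu with
  | short hz => exact ⟨fun h => by omega, fun n h => by omega⟩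
  | @step z u hz _ ih =>
    have hfirst : w <+: (z ++ (w ++ u)).drop z.length := by simp
    have hlater : ∀ p, w <+: u.drop p → w <+: (z ++ (w ++ u)).drop (z.length + w.length + p) := by
      intro p hp
      rwa [← List.drop_drop, ← List.drop_drop, List.drop_left, List.drop_left]
    simp only [List.length_append]
    refine ⟨fun _ => ⟨_, hz, hfirst⟩, fun n hn => ?_⟩
    rcases le_or_gt n z.length with h | h
    · exact ⟨z.length - n, by omega, by rwa [Nat.add_sub_cancel' h]⟩
    rcases le_or_gt n (z.length + w.length) with h' | h'
    · obtain ⟨p, hp, hpre⟩ := ih.1 (by omega)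
      refine ⟨z.length + w.length + p - n, by omega, ?_⟩
      rw [Nat.add_sub_cancel' (by omega)]
      exact hlater p hpre
    · obtain ⟨j, hj, hpre⟩ := ih.2 (n - (z.length + w.length)) (by omega)
      refine ⟨j, hj, ?_⟩
      convert hlater _ hpre using 2
      omega

/-- The word `u`, placed at position `a`, takes the value `true` only on `A`. -/
def FitsAt (A : Set ℕ) (a : ℕ) (u : List Bool) : Prop :=
  ∀ i, u[i]? = some true → a + i ∈ A

lemma FitsAt.append {A : Set ℕ} {a : ℕ} {u v : List Bool} (hu : FitsAt A a u)
    (hv : FitsAt A (a + u.length) v) : FitsAt A a (u ++ v) := by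
  intro i hi
  rw [List.getElem?_append] at hi
  split_ifs at hi with h
  · exact hu i hi
  · have := hv _ hi
    rwa [show a + u.length + (i - u.length) = a + i by omega] at this

lemma fitsAt_of_forall {A : Set ℕ} {a : ℕ} {u : List Bool} (h : ∀ i < u.length, a + i ∈ A) :
    FitsAt A a u := fun i hi => h i (List.getElem?_eq_some_iff.1 hi).1

/-- A stage of the construction of a uniformly recurrent word supported in `A`: a word `w` together
with a family of fillers, available with any length at any position, that absorbs `w`. -/
structure Stage (A : Set ℕ) where
  word : List Bool
  fillers : Set (List Bool)
  nil_mem : [] ∈ fillers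
  absorb : ∀ u ∈ fillers, ∀ v ∈ fillers, u ++ (word ++ v) ∈ fillers
  exists_filler : ∀ a n, ∃ f ∈ fillers, f.length = n ∧ FitsAt A a f
  word_ne_nil : word ≠ []
  word_fits : FitsAt A 0 word

lemma Stage.word_mem {A : Set ℕ} (s : Stage A) : s.word ∈ s.fillers := by
  simpa using s.absorb [] s.nil_mem [] s.nil_mem

/-- `A` contains, with bounded gaps, intervals of every length. -/
def ThickSyndetic (A : Set ℕ) : Prop :=
  ∀ L, Syndetic {p | ∀ i < L, p + i ∈ A}

lemma Stage.exists_next {A : Set ℕ} (hA : ThickSyndetic A) (s : Stage A) :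
    ∃ t : Stage A, s.word <+: t.word ∧ s.word.length < t.word.length ∧ t.fillers ⊆ s.fillers ∧
      ∃ D, ∀ u ∈ t.fillers, Spaced s.word D u := by
  obtain ⟨g, hg⟩ := hA s.word.length
  have hpos : 0 < s.word.length := List.length_pos_of_ne_nil s.word_ne_nil
  obtain ⟨q, hq, hqA⟩ := hg s.word.length
  obtain ⟨f, hf, hfl, hfA⟩ := s.exists_filler s.word.length q
  let D := g + s.word.length
  have hfS : Spaced s.word D f := .short (by omega)
  have hfill : ∀ n a, ∃ f ∈ {u ∈ s.fillers | Spaced s.word D u}, f.length = n ∧ FitsAt A a f := by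
    intro n
    induction n using Nat.strong_induction_on with
    | _ n ih =>
      intro a
      rcases le_or_gt n D with hn | hn
      · obtain ⟨f, hf, hl, hfA⟩ := s.exists_filler a n
        exact ⟨f, ⟨hf, .short (by omega)⟩, hl, hfA⟩
      · obtain ⟨j, hj, hjA⟩ := hg a
        obtain ⟨f, hf, hl, hfA⟩ := s.exists_filler a j
        obtain ⟨v, ⟨hv, hvS⟩, hvl, hvA⟩ := ih (n - (j + s.word.length)) (by omega)
          (a + j + s.word.length)
        refine ⟨f ++ (s.word ++ v), ⟨s.absorb f hf v hv, .step (by omega) hvS⟩, ?_, ?_⟩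
        · simp only [List.length_append]; omega
        · refine hfA.append ((fitsAt_of_forall ?_).append ?_)
          · rwa [hl]
          · rwa [hl]
  refine ⟨⟨s.word ++ (f ++ s.word), {u ∈ s.fillers | Spaced s.word D u},
    ⟨s.nil_mem, .short (by simp)⟩,
    ?_, fun a n => hfill n a, by simp [s.word_ne_nil], ?_⟩, ?_, ?_, fun u hu => hu.1,
    D, fun u hu => hu.2⟩
  · rintro u ⟨hu, huS⟩ v ⟨hv, hvS⟩
    have h₁ := s.absorb u hu _ (s.absorb f hf v hv)
    have h₂ := huS.append (hfS.append hvS)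
    exact ⟨by simpa using h₁, by simpa using h₂⟩
  · refine s.word_fits.append (FitsAt.append ?_ (fitsAt_of_forall ?_))
    · rwa [zero_add]
    · rwa [hfl, zero_add]
  · exact List.prefix_append _ _
  · simp only [List.length_append]; omega

/-- A nonempty set with bounded-gap intervals of every length contains the support of a nonzero
uniformly recurrent sequence. -/
lemma ThickSyndetic.exists_uniformly_recurrent {A : Set ℕ} (hA : ThickSyndetic A) :
    ∃ y : ℕ → Bool, (∃ n, y n = true) ∧ (∀ n, y n = true → n ∈ A) ∧
      ∀ L, Syndetic {n | ∀ i < L, y (n + i) = y i} := by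
  obtain ⟨a, -, ha⟩ := (hA 1).choose_spec 0
  replace ha : a ∈ A := by simpa using ha
  let s₀ : Stage A :=
    { word := List.replicate a false ++ [true]
      fillers := univ
      nil_mem := trivial
      absorb := fun _ _ _ _ => trivial
      exists_filler := fun b n => ⟨List.replicate n false, trivial, by simp, fun i hi => by
        simp [List.getElem?_replicate] at hi⟩
      word_ne_nil := by simp
      word_fits := FitsAt.append (fun i hi => by simp [List.getElem?_replicate] at hi)
        (fitsAt_of_forall fun i hi => by
          obtain rfl : i = 0 := by simpa using hi
          simpa using ha) }
  choose next hpre hlt hsub gap hgap using fun s : Stage A => s.exists_next hA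
  let s : ℕ → Stage A := fun k => next^[k] s₀
  have hs : ∀ k, s (k + 1) = next (s k) := fun k => iterate_succ_apply' next k s₀
  have hmono : ∀ j k, j ≤ k → (s j).word <+: (s k).word := fun j k hjk => by
    induction k, hjk using Nat.le_induction with
    | base => exact List.prefix_rfl
    | succ k _ ih => exact ih.trans (hs k ▸ hpre (s k))
  have hfmono : ∀ j k, j ≤ k → (s k).fillers ⊆ (s j).fillers := fun j k hjk => by
    induction k, hjk using Nat.le_induction with
    | base => exact Subset.rfl
    | succ k _ ih => exact (hs k ▸ hsub (s k) : (s (k + 1)).fillers ⊆ _).trans ih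
  have hlen : ∀ k, k < (s k).word.length := fun k => by
    induction k with
    | zero => exact List.length_pos_of_ne_nil (s 0).word_ne_nil
    | succ k ih => exact lt_of_le_of_lt ih (hs k ▸ hlt (s k))
  let y : ℕ → Bool := fun i => (s i).word[i]'(hlen i)
  have hy : ∀ k i, i < (s k).word.length → (s k).word[i]? = some (y i) := by
    intro k i hi
    have hyi : (s i).word[i]? = some (y i) := List.getElem?_eq_getElem (hlen i)
    rcases le_total i k with h | h
    · exact (List.prefix_iff_getElem?.1 (hmono i k h) i (hlen i)).trans
        (List.getElem?_eq_getElem (hlen i)).symm |>.trans hyi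
    · rw [← hyi, List.prefix_iff_getElem?.1 (hmono k i h) i hi, List.getElem?_eq_getElem hi]
  refine ⟨y, ⟨a, ?_⟩, fun n hn => ?_, fun L => ?_⟩
  · have := hy 0 a (by simp [s, s₀])
    simpa [s, s₀] using this.symm
  · have := (s n).word_fits n (by rw [hy n n (hlen n), hn])
    rwa [zero_add] at this
  · refine ⟨(s L).word.length + gap (s L), fun n => ?_⟩
    let k := n + 2 * (gap (s L) + (s L).word.length) + (L + 1)
    have hSp : Spaced (s L).word (gap (s L)) (s k).word :=
      hgap (s L) _ (hs L ▸ hfmono (L + 1) k (by omega) (s k).word_mem)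
    obtain ⟨j, hj, hp⟩ := hSp.exists_prefix_drop.2 n (by have := hlen k; omega)
    refine ⟨j, hj, fun i hi => ?_⟩
    have hiL : i < (s L).word.length := hi.trans (hlen L)
    have h₁ := List.prefix_iff_getElem?.1 hp i hiL
    rw [List.getElem?_drop, ← List.getElem?_eq_getElem hiL, hy L i hiL] at h₁
    have hlt' := (List.getElem?_eq_some_iff.1 h₁).1
    rw [hy k _ hlt'] at h₁
    exact Option.some.inj h₁

/-- The shift on binary sequences. -/
def boolShift (y : ℕ → Bool) : ℕ → Bool := fun n => y (n + 1)

lemma continuous_boolShift : Continuous boolShift :=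
  continuous_pi fun n => continuous_apply (n + 1)

lemma boolShift_iterate_apply (n : ℕ) (y : ℕ → Bool) (i : ℕ) :
    boolShift^[n] y i = y (n + i) := by
  induction n generalizing i with
  | zero => simp
  | succ n ih =>
    rw [iterate_succ_apply']
    change boolShift^[n] y (i + 1) = _
    rw [ih]
    congr 1
    omega

lemma isMinimalPoint_boolShift {y : ℕ → Bool}
    (hy : ∀ L, Syndetic {n | ∀ i < L, y (n + i) = y i}) : IsMinimalPoint boolShift y := by
  refine isMinimalPoint_of_syndetic continuous_boolShift fun W hW => ?_
  rw [nhds_pi, Filter.mem_pi'] at hW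
  obtain ⟨I, t, ht, hIt⟩ := hW
  obtain ⟨N, hN⟩ := hy (I.sup id + 1)
  refine ⟨N, fun n => ?_⟩
  obtain ⟨j, hj, h⟩ := hN n
  refine ⟨j, hj, hIt fun i hi => ?_⟩
  rw [boolShift_iterate_apply, h i (Nat.lt_succ_of_le (Finset.le_sup (f := id) hi))]
  exact mem_of_mem_nhds (ht i)

/-- If no minimal point lies in the closed set `K`, then every point stays outside `K` along a set
of times containing, with bounded gaps, intervals of every length. -/
lemma thickSyndetic_of_isMinimalPoint_notMem {X : Type*} [TopologicalSpace X] [CompactSpace X]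
    {T : X → X} (hT : Continuous T) {K : Set X} (hK : IsClosed K)
    (h : ∀ w, IsMinimalPoint T w → w ∉ K) (x : X) : ThickSyndetic {n | T^[n] x ∉ K} := by
  intro L
  let O : Set X := ⋂ i ∈ Iio L, T^[i] ⁻¹' Kᶜ
  have hO : IsOpen O :=
    (finite_Iio L).isOpen_biInter fun i _ => hK.isOpen_compl.preimage (hT.iterate i)
  have hcover : (univ : Set X) ⊆ ⋃ p : ℕ, T^[p] ⁻¹' O := by
    intro z _
    obtain ⟨w, hw, hmin⟩ := exists_isMinimalPoint_mem_closure_orbit hT z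
    have hwO : w ∈ O := by
      refine mem_iInter₂.2 fun i _ => h _ ?_
      have hmem : ∀ n, T^[n] w ∈ closure (orbit T w) := fun n => subset_closure ⟨n, rfl⟩
      have hsub : ∀ v ∈ closure (orbit T w), closure (orbit T v) ⊆ closure (orbit T w) :=
        fun v hv => closure_orbit_subset isClosed_closure (fun _ => map_mem_closure_orbit hT) hv
      exact fun v hv => (hsub _ (hmem i)).trans (hmin v (hsub _ (hmem i) hv))
    obtain ⟨_, hpO, p, rfl⟩ := mem_closure_iff.1 hw O hO hwO
    exact mem_iUnion.2 ⟨p, hpO⟩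
  obtain ⟨F, hF⟩ := isCompact_univ.elim_finite_subcover _
    (fun p => hO.preimage (hT.iterate p)) hcover
  refine ⟨F.sup id, fun n => ?_⟩
  obtain ⟨p, hp, hpO⟩ := mem_iUnion₂.1 (hF (mem_univ (T^[n] x)))
  refine ⟨p, Finset.le_sup (f := id) hp, fun i hi => ?_⟩
  have := mem_iInter₂.1 hpO i hi
  rw [mem_preimage, ← iterate_add_apply, ← iterate_add_apply] at this
  change T^[n + p + i] x ∉ K
  rwa [show n + p + i = i + (p + n) by omega, iterate_add_apply, iterate_add_apply,
    ← iterate_add_apply, ← iterate_add_apply]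

theorem stmt_19 {X : Type} [MetricSpace X] [CompactSpace X] (T : X → X)
    (hTc : Continuous T) (hTs : Function.Surjective T) (hTtr : IsTransitiveSys T)
    (hdisj : ∀ 𝒴 : TDS, IsMinimalSys 𝒴.map → DisjointSys T 𝒴.map) :
    IsWeaklyMixingSys T ∧ Dense {x : X | IsMinimalPoint T x} := by
  rcases isEmpty_or_nonempty X with hX | hX
  · refine ⟨?_, fun x => isEmptyElim x⟩
    rintro U - - - ⟨p, -⟩
    exact isEmptyElim p.1
  obtain ⟨x, hx⟩ := hTtr.exists_dense_orbit hTc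
  have hdense : Dense {x : X | IsMinimalPoint T x} := by
    rw [dense_iff_inter_open]
    rintro U hU ⟨u, hu⟩
    by_contra hne
    obtain ⟨K, hK, hKc, hKU⟩ := exists_mem_nhds_isClosed_subset (hU.mem_nhds hu)
    have hA := thickSyndetic_of_isMinimalPoint_notMem hTc hKc
      (fun w hw hwK => hne ⟨w, hKU hwK, hw⟩) x
    obtain ⟨y, ⟨k, hk⟩, hyA, hy⟩ := hA.exists_uniformly_recurrent
    have hO : IsOpen {y : ℕ → Bool | y 0 = true} :=
      (isOpen_discrete {true}).preimage (continuous_apply (A := fun _ : ℕ => Bool) 0)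
    obtain ⟨n, hnK, hn⟩ := exists_common_hit hTc hdisj continuous_boolShift hx
      (isMinimalPoint_boolShift hy) isOpen_interior ⟨u, mem_interior_iff_mem_nhds.2 hK⟩ hO (k := k)
      (by simpa [boolShift_iterate_apply] using hk)
    refine hyA n ?_ (interior_subset hnK)
    simpa [boolShift_iterate_apply] using hn
  refine ⟨isWeaklyMixingSys_of_inter hTc hTs hTtr fun U V hU hV hUne hVne => ?_, hdense⟩
  obtain ⟨z, hzU, hz⟩ := hdense.inter_open_nonempty U hU hUne
  obtain ⟨n, hxn, hzn⟩ := exists_common_hit hTc hdisj hTc hx hz hU hUne hU (k := 0) hzU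
  obtain ⟨m, hxm, hzm⟩ := exists_common_hit hTc hdisj hTc (hx.orbit_iterate hTc hTs n) hz hV hVne
    (hU.preimage (hTc.iterate n)) (k := 0) hzn
  refine ⟨m, ⟨T^[n] z, hzn, ?_⟩, ⟨T^[n] x, hxn, hxm⟩⟩
  rw [mem_preimage, ← iterate_add_apply, Nat.add_comm, iterate_add_apply]
  exact hzm
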